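/- Let (Ω, 𝒜, ℙ) be a probability space, let D be a positive integer, and let E and F be standard Borel spaces. Let U : Ω → (0,1)^D be a random vector whose law is the D-fold product of the uniform (Lebesgue) measure on (0,1), let g : (0,1)^D → E × F be measurable, and write (θ, Y) = g(U), where θ : Ω → E and Y : Ω → F are the two component random elements. Suppose Y⁰ : Ω → F, θ̃ : Ω → E, and Ũ : Ω → (0,1)^D are measurable random elements such that: (i) Y⁰ has the same law as Y; (ii) the joint law of (Y⁰, θ̃) equals the composition-product of the law of Y⁰ with the kernel condDistrib θ Y ℙ; and (iii) the joint law of ((θ̃, Y⁰), Ũ) equals the composition-product of the law of (θ̃, Y⁰) with the kernel condDistrib U (θ, Y) ℙ. Then Ũ has the same law as U; in particular, the law of Ũ is the D-fold product of the uniform measure on (0,1). -/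

import Mathlib

open MeasureTheory ProbabilityTheory

/-- The open unit interval `(0,1)` is a standard Borel space. -/
instance : StandardBorelSpace ↥(Set.Ioo (0:ℝ) 1) := measurableSet_Ioo.standardBorel

instance : Nonempty ↥(Set.Ioo (0:ℝ) 1) := ⟨⟨1/2, by norm_num⟩⟩

/-- The uniform distribution on `(0,1)`: Lebesgue measure (`volume`) on the subtype
`(0,1) ⊆ ℝ`, i.e. the comap of Lebesgue measure along the inclusion. -/
noncomputable def uniform01 : Measure ↥(Set.Ioo (0:ℝ) 1) :=
  (volume : Measure ℝ).comap Subtype.val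

/-- If `X'` has the law of `X`, and `Z'` given `X'` is drawn from the conditional distribution of
`Z` given `X`, then `(X', Z')` has the law of `(X, Z)`. -/
lemma map_prodMk_eq_of_eq_compProd_condDistrib
    {Ω A B : Type*} [MeasurableSpace Ω] [MeasurableSpace A]
    [MeasurableSpace B] [StandardBorelSpace B] [Nonempty B]
    {μ : Measure Ω} [IsFiniteMeasure μ] {X X' : Ω → A} {Z Z' : Ω → B}
    (hZ : AEMeasurable Z μ) (hlaw : μ.map X' = μ.map X)
    (h : μ.map (fun ω => (X' ω, Z' ω)) = (μ.map X') ⊗ₘ (condDistrib Z X μ)) :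
    μ.map (fun ω => (X' ω, Z' ω)) = μ.map (fun ω => (X ω, Z ω)) := by
  rw [h, hlaw, compProd_map_condDistrib hZ]

/-- **Theorem 1 (self-consistency), u-value marginal.** If `(θ, Y) = g(U)` with `U` uniform on
`(0,1)^D`, the observed data `Y0` has the same law as `Y`, the posterior draw `θt` is drawn from
`condDistrib θ Y μ` given `Y0`, and `Ut` is drawn from `condDistrib U (θ, Y) μ` given
`(θt, Y0)`, then `Ut` has the same law as `U`, namely the `D`-fold product of uniforms. -/
theorem selfConsistency_uvalues
    {Ω E F : Type*} [MeasurableSpace Ω]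
    [MeasurableSpace E] [StandardBorelSpace E] [Nonempty E]
    [MeasurableSpace F] [StandardBorelSpace F] [Nonempty F]
    (μ : Measure Ω) [IsProbabilityMeasure μ]
    (D : ℕ) (hD : 0 < D)
    (U Ut : Ω → (Fin D → ↥(Set.Ioo (0:ℝ) 1)))
    (hU : Measurable U) (hUt : Measurable Ut)
    (hUlaw : μ.map U = Measure.pi (fun _ : Fin D => uniform01))
    (g : (Fin D → ↥(Set.Ioo (0:ℝ) 1)) → E × F) (hg : Measurable g)
    (θ : Ω → E) (Y : Ω → F)
    (hθ : θ = fun ω => (g (U ω)).1) (hY : Y = fun ω => (g (U ω)).2)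
    (Y0 : Ω → F) (θt : Ω → E)
    (hY0 : Measurable Y0) (hθt : Measurable θt)
    (hlawY : μ.map Y0 = μ.map Y)
    (hpost : μ.map (fun ω => (Y0 ω, θt ω)) = (μ.map Y0) ⊗ₘ (condDistrib θ Y μ))
    (hpostU : μ.map (fun ω => ((θt ω, Y0 ω), Ut ω)) =
      (μ.map (fun ω => (θt ω, Y0 ω))) ⊗ₘ (condDistrib U (fun ω => (θ ω, Y ω)) μ)) :
    μ.map Ut = μ.map U ∧ μ.map Ut = Measure.pi (fun _ : Fin D => uniform01) := by
  have hθm : Measurable θ := hθ ▸ (hg.comp hU).fst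
  have hYm : Measurable Y := hY ▸ (hg.comp hU).snd
  have hYθ := map_prodMk_eq_of_eq_compProd_condDistrib hθm.aemeasurable hlawY hpost
  have hθY : μ.map (fun ω => (θt ω, Y0 ω)) = μ.map (fun ω => (θ ω, Y ω)) := by
    have := congrArg (Measure.map Prod.swap) hYθ
    rwa [Measure.map_map measurable_swap (hY0.prodMk hθt),
      Measure.map_map measurable_swap (hYm.prodMk hθm)] at this
  have hjoint := map_prodMk_eq_of_eq_compProd_condDistrib hU.aemeasurable hθY hpostU
  have hlaw : μ.map Ut = μ.map U := by
    have := congrArg (Measure.map Prod.snd) hjoint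
    rwa [Measure.map_map measurable_snd ((hθt.prodMk hY0).prodMk hUt),
      Measure.map_map measurable_snd ((hθm.prodMk hYm).prodMk hU)] at this
  exact ⟨hlaw, hlaw.trans hUlaw⟩
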